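/- For each N ∈ ℕ, let x(N) be an ℝ^N-valued random variable and O(N) a Haar-distributed N×N orthogonal random matrix independent of x(N), all on a common probability space. Assume there exists r > 0 such that √((1/N)∑_{n=1}^N x(N)_n²) → r almost surely as N → ∞. Set h(N) = O(N)x(N). Then the empirical distribution ν_{h(N)} = (1/N)∑_{n=1}^N δ_{h(N)_n} converges weakly to the Gaussian distribution N(0, r²) almost surely as N → ∞. -/

import Mathlib

open MeasureTheory ProbabilityTheory Filter Topology Matrix BoundedContinuousFunction
open scoped ENNReal NNReal

/-- Matrices inherit the product measurable structure on their entries. -/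
instance {m n α : Type*} [MeasurableSpace α] : MeasurableSpace (Matrix m n α) :=
  inferInstanceAs (MeasurableSpace (m → n → α))

/-- The empirical distribution `(1/N) ∑ₙ δ_{v n}` of the entries of a vector `v ∈ ℝ^N`. -/
noncomputable def empDist {N : ℕ} (v : Fin N → ℝ) : Measure ℝ :=
  ((N : ℝ≥0∞))⁻¹ • ∑ n : Fin N, Measure.dirac (v n)

/-- `V` is a Haar-distributed `N × N` orthogonal random matrix: it is measurable, takes values
in the orthogonal group `O(N)`, and its law is invariant under left and right translation by
every fixed orthogonal matrix.  On the compact group `O(N)` this characterizes the unique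
Haar probability measure. -/
def IsHaarOrthogonal {N : ℕ} {Ω : Type*} [MeasurableSpace Ω] (μ : Measure Ω)
    (V : Ω → Matrix (Fin N) (Fin N) ℝ) : Prop :=
  Measurable V ∧ (∀ ω, V ω ∈ Matrix.orthogonalGroup (Fin N) ℝ) ∧
    (∀ U ∈ Matrix.orthogonalGroup (Fin N) ℝ,
      Measure.map (fun ω => U * V ω) μ = Measure.map V μ) ∧
    (∀ U ∈ Matrix.orthogonalGroup (Fin N) ℝ,
      Measure.map (fun ω => V ω * U) μ = Measure.map V μ)


noncomputable abbrev gam : Measure ℝ := gaussianReal 0 1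

lemma chern (Y : ℝ → ℝ)
    (h0 : (0:ℝ) ∈ interior (integrableExpSet Y gam)) (hm : ∫ y, Y y ∂gam = 0) (ε : ℝ) (hε : 0 < ε) :
    ∃ ρ : ℝ, 0 ≤ ρ ∧ ρ < 1 ∧ ∀ N : ℕ,
      (Measure.pi (fun _ : Fin N => gam)).real {g | (N:ℝ) * ε ≤ ∑ n, Y (g n)} ≤ ρ ^ N := by
  have hd : HasDerivAt (fun t : ℝ => Real.exp (-t * ε) * mgf Y gam t) (-ε) 0 := by
    have h1 := hasDerivAt_mgf h0
    have h2 : HasDerivAt (fun t : ℝ => Real.exp (-t * ε)) (-ε) 0 := by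
      have := (((hasDerivAt_id (0:ℝ)).neg).mul_const ε).exp
      simpa using this
    have := h2.mul h1
    convert! this using 1
    simp [hm]
  have hs := hasDerivAt_iff_tendsto_slope.1 hd
  have hs' : ∀ᶠ t in 𝓝[>] (0:ℝ), slope (fun t : ℝ => Real.exp (-t * ε) * mgf Y gam t) 0 t < 0 := by
    have := (hs.mono_left (nhdsWithin_mono (0:ℝ) (s := Set.Ioi 0) (t := {0}ᶜ)
      (fun x hx => ne_of_gt hx))).eventually_lt_const (u := 0) (by linarith)
    exact this
  have hi : ∀ᶠ t in 𝓝[>] (0:ℝ), t ∈ integrableExpSet Y gam :=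
    nhdsWithin_le_nhds (mem_interior_iff_mem_nhds.1 h0)
  obtain ⟨t, ⟨ht1, ht2⟩, ht0⟩ := ((hs'.and hi).and self_mem_nhdsWithin).exists
  have ht0 : 0 < t := ht0
  refine ⟨Real.exp (-t * ε) * mgf Y gam t, mul_nonneg (Real.exp_pos _).le mgf_nonneg, ?_, ?_⟩
  · rw [slope_def_field] at ht1
    simp only [sub_zero, neg_zero, zero_mul, Real.exp_zero, one_mul, mgf_zero] at ht1
    simp at ht1
    rw [div_lt_iff₀ ht0] at ht1
    simp only [neg_mul]
    linarith
  · intro N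
    have hprod : ∀ g : Fin N → ℝ, Real.exp (t * ∑ n, Y (g n)) = ∏ n, Real.exp (t * Y (g n)) := by
      intro g; rw [Finset.mul_sum, Real.exp_sum]
    have hint : Integrable (fun g : Fin N → ℝ => Real.exp (t * ∑ n, Y (g n)))
        (Measure.pi (fun _ : Fin N => gam)) := by
      simp_rw [hprod]
      exact Integrable.fintype_prod (f := fun _ : Fin N => fun y => Real.exp (t * Y y)) (fun _ => ht2)
    have := measure_ge_le_exp_mul_mgf (μ := Measure.pi (fun _ : Fin N => gam))
      (X := fun g => ∑ n, Y (g n)) ((N:ℝ) * ε) ht0.le hint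
    refine this.trans (le_of_eq ?_)
    rw [mul_pow, ← Real.exp_nat_mul]
    congr 1
    · congr 1; ring
    · simp only [mgf, hprod]
      rw [integral_fintype_prod_eq_pow (ι := Fin N) (fun y => Real.exp (t * Y y))]
      simp

lemma chern2 (Y : ℝ → ℝ)
    (h0 : (0:ℝ) ∈ interior (integrableExpSet Y gam)) (hm : ∫ y, Y y ∂gam = 0) (ε : ℝ) (hε : 0 < ε) :
    (∑' N : ℕ, (Measure.pi (fun _ : Fin N => gam)) {g | (N:ℝ) * ε ≤ |∑ n, Y (g n)|}) ≠ ∞ := by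
  obtain ⟨a, ha0, ha1, ha⟩ := chern Y h0 hm ε hε
  obtain ⟨b, hb0, hb1, hb⟩ := chern (fun y => - Y y) (by
    rw [mem_interior_iff_mem_nhds] at h0 ⊢
    have : Tendsto (fun t : ℝ => -t) (𝓝 0) (𝓝 0) := by
      simpa using (continuous_neg (G := ℝ)).tendsto 0
    filter_upwards [this h0] with t ht
    have ht : Integrable _ _ := ht
    change Integrable _ _
    simpa using ht) (by rw [integral_neg, hm, neg_zero]) ε hε
  have hb' : ∀ N : ℕ, (Measure.pi (fun _ : Fin N => gam)) {g | (N:ℝ) * ε ≤ |∑ n, Y (g n)|}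
      ≤ ENNReal.ofReal (a ^ N + b ^ N) := by
    intro N
    rw [ENNReal.le_ofReal_iff_toReal_le (measure_ne_top _ _) (by positivity)]
    refine le_trans ?_ (add_le_add (ha N) (hb N))
    have hsub : {g : Fin N → ℝ | (N:ℝ) * ε ≤ |∑ n, Y (g n)|} ⊆ {g | (N:ℝ) * ε ≤ ∑ n, Y (g n)} ∪
        {g | (N:ℝ) * ε ≤ ∑ n, - Y (g n)} := by
      intro g hg
      simp only [Set.mem_ofPred_eq, Set.mem_union, Finset.sum_neg_distrib] at hg ⊢
      exact le_abs.1 hg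
    have h1 := measureReal_mono (μ := Measure.pi (fun _ : Fin N => gam)) hsub (measure_ne_top _ _)
    have h2 := measureReal_union_le (μ := Measure.pi (fun _ : Fin N => gam))
      {g | (N:ℝ) * ε ≤ ∑ n, Y (g n)} {g | (N:ℝ) * ε ≤ ∑ n, - Y (g n)}
    exact h1.trans h2
  refine ne_top_of_le_ne_top ?_ (ENNReal.tsum_le_tsum hb')
  exact ((summable_geometric_of_lt_one ha0 ha1).add
    (summable_geometric_of_lt_one hb0 hb1)).tsum_ofReal_ne_top

lemma exp_sq : (0:ℝ) ∈ interior (integrableExpSet (fun y : ℝ => y ^ 2 - 1) gam) := by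
  obtain ⟨C, hC, hi⟩ := IsGaussian.exists_integrable_exp_sq (μ := gam)
  rw [mem_interior_iff_mem_nhds]
  filter_upwards [Ioo_mem_nhds (neg_lt_zero.2 hC) hC] with t ht
  change Integrable _ _
  refine (hi.const_mul (Real.exp C)).mono (by fun_prop) (ae_of_all _ fun y => ?_)
  rw [Real.norm_of_nonneg (by positivity), Real.norm_of_nonneg (by positivity), ← Real.exp_add]
  apply Real.exp_le_exp.2
  rw [Real.norm_eq_abs, sq_abs]
  nlinarith [ht.1, ht.2, sq_nonneg y, mul_nonneg (sub_nonneg.2 ht.2.le) (sq_nonneg y)]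

lemma exp_bdd (F : ℝ → ℝ) (hF : Measurable F) (B : ℝ) (hB : ∀ y, |F y| ≤ B) :
    (0:ℝ) ∈ interior (integrableExpSet F gam) := by
  have : integrableExpSet F gam = Set.univ := by
    ext t
    simp only [Set.mem_univ, iff_true]
    refine Integrable.of_bound (by fun_prop) (Real.exp (|t| * B)) (ae_of_all _ fun y => ?_)
    rw [Real.norm_of_nonneg (by positivity)]
    apply Real.exp_le_exp.2
    refine (le_abs_self _).trans ?_
    rw [abs_mul]
    exact mul_le_mul_of_nonneg_left (hB y) (abs_nonneg _)
  simp [this]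

lemma mean_sq : ∫ y, (y ^ 2 - 1) ∂gam = 0 := by
  have h := variance_id_gaussianReal (μ := 0) (v := 1)
  rw [variance_eq_sub IsGaussian.memLp_two_id] at h
  rw [integral_sub]
  · simp at h
    simp [h]
  · exact IsGaussian.memLp_two_id.integrable_sq
  · exact integrable_const _

lemma rot_norm {N : ℕ} (U : Matrix (Fin N) (Fin N) ℝ) (hU : U ∈ Matrix.orthogonalGroup (Fin N) ℝ)
    (v : Fin N → ℝ) : ∑ n, (U *ᵥ v) n ^ 2 = ∑ n, v n ^ 2 := by
  have h1 : Uᵀ * U = 1 := (Matrix.mem_orthogonalGroup_iff' (Fin N) ℝ).1 hU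
  have : (U *ᵥ v) ⬝ᵥ (U *ᵥ v) = v ⬝ᵥ v := by
    rw [Matrix.dotProduct_mulVec, Matrix.vecMul_mulVec, h1, Matrix.vecMul_one]
  simpa [dotProduct, sq] using this

lemma gauss_rot {N : ℕ} (U : Matrix (Fin N) (Fin N) ℝ)
    (hU : U ∈ Matrix.orthogonalGroup (Fin N) ℝ) :
    (Measure.pi (fun _ : Fin N => gam)).map (fun v => U *ᵥ v) = Measure.pi (fun _ : Fin N => gam) := by
  let f : EuclideanSpace ℝ (Fin N) →ₗᵢ[ℝ] EuclideanSpace ℝ (Fin N) :=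
    { toLinearMap := Matrix.toEuclideanLin U
      norm_map' := by
        intro x
        rw [EuclideanSpace.norm_eq, EuclideanSpace.norm_eq]
        congr 1
        simpa [Matrix.toEuclideanLin] using rot_norm U hU x.ofLp }
  let e := f.toLinearIsometryEquiv rfl
  have h1 := stdGaussian_map e
  rw [← map_pi_eq_stdGaussian] at h1
  have h2 := congrArg (Measure.map (WithLp.ofLp : EuclideanSpace ℝ (Fin N) → (Fin N → ℝ))) h1
  rw [Measure.map_map (by fun_prop) (by fun_prop), Measure.map_map (by fun_prop) (by fun_prop),
    Measure.map_map (by fun_prop) (by fun_prop)] at h2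
  have e2 : (WithLp.ofLp : EuclideanSpace ℝ (Fin N) → (Fin N → ℝ)) ∘ WithLp.toLp 2 = id := rfl
  rw [e2, Measure.map_id] at h2
  exact h2

lemma refl_exists {N : ℕ} (v w : Fin N → ℝ) (h : v ⬝ᵥ v = w ⬝ᵥ w) :
    ∃ U ∈ Matrix.orthogonalGroup (Fin N) ℝ, U *ᵥ v = w := by
  by_cases hvw : v = w
  · exact ⟨1, one_mem _, by simp [hvw]⟩
  set d := v - w with hd
  have hdd : d ⬝ᵥ d ≠ 0 := by
    rw [Ne, dotProduct_self_eq_zero]; exact sub_ne_zero.2 hvw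
  have hdv : 2 * (d ⬝ᵥ v) = d ⬝ᵥ d := by
    simp only [hd, sub_dotProduct, dotProduct_sub, dotProduct_comm w v]
    linarith
  refine ⟨1 - (2 / (d ⬝ᵥ d)) • Matrix.vecMulVec d d, ?_, ?_⟩
  · rw [Matrix.mem_orthogonalGroup_iff]
    change _ * Matrix.transpose _ = _
    simp only [Matrix.transpose_sub, Matrix.transpose_one, Matrix.transpose_smul,
      Matrix.transpose_vecMulVec, mul_sub, sub_mul, mul_one, one_mul, smul_mul_assoc,
      mul_smul_comm, Matrix.vecMulVec_mul_vecMulVec, smul_smul]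
    ext i j
    simp [Matrix.vecMulVec_apply]
    field_simp
    ring
  · rw [Matrix.sub_mulVec, Matrix.one_mulVec, Matrix.smul_mulVec, Matrix.vecMulVec_mulVec]
    ext i
    simp
    have : 2 / (d ⬝ᵥ d) * (d ⬝ᵥ v * d i) = d i := by
      field_simp; linear_combination d i * hdv
    rw [this, hd]; simp

lemma meas_mulVec {N : ℕ} : Measurable (fun p : Matrix (Fin N) (Fin N) ℝ × (Fin N → ℝ) => p.1 *ᵥ p.2) := by
  refine measurable_pi_lambda _ fun i => ?_
  simp only [Matrix.mulVec, dotProduct]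
  refine Finset.measurable_sum _ fun j _ => Measurable.mul ?_ ?_
  · exact (measurable_pi_apply j).comp ((measurable_pi_apply (X := fun _ : Fin N => Fin N → ℝ) i).comp measurable_fst)
  · exact (measurable_pi_apply j).comp measurable_snd

lemma meas_mulR {N : ℕ} (U : Matrix (Fin N) (Fin N) ℝ) :
    Measurable (fun M : Matrix (Fin N) (Fin N) ℝ => M * U) := by
  refine measurable_pi_lambda _ fun i => measurable_pi_lambda _ fun k => ?_
  simp only [Matrix.mul_apply]
  refine Finset.measurable_sum _ fun j _ => Measurable.mul_const ?_ _
  exact (measurable_pi_apply j).comp (measurable_pi_apply (X := fun _ : Fin N => Fin N → ℝ) i)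

lemma transfer {N : ℕ} {Ω : Type*} [MeasurableSpace Ω] (μ : Measure Ω) [IsProbabilityMeasure μ]
    (V : Ω → Matrix (Fin N) (Fin N) ℝ) (hV : IsHaarOrthogonal μ V) (y : Ω → Fin N → ℝ)
    (hy : Measurable y) (hind : IndepFun V y μ) (A : Set (Fin N → ℝ)) (hA : MeasurableSet A)
    (hs : ∀ c : ℝ, 0 < c → ∀ v, c • v ∈ A ↔ v ∈ A) (h0 : (0 : Fin N → ℝ) ∉ A) :
    μ {ω | V ω *ᵥ y ω ∈ A} ≤ Measure.pi (fun _ : Fin N => gam) A := by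
  obtain ⟨hVm, hVo, -, hVr⟩ := hV
  have : IsProbabilityMeasure (μ.map V) := Measure.isProbabilityMeasure_map hVm.aemeasurable
  have : IsProbabilityMeasure (μ.map y) := Measure.isProbabilityMeasure_map hy.aemeasurable
  set S : Set (Matrix (Fin N) (Fin N) ℝ × (Fin N → ℝ)) := {p | p.1 *ᵥ p.2 ∈ A} with hS
  have hSm : MeasurableSet S := meas_mulVec hA
  have hsec : ∀ v, MeasurableSet {M : Matrix (Fin N) (Fin N) ℝ | M *ᵥ v ∈ A} := fun v =>
    (meas_mulVec.comp measurable_prodMk_right) hA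
  let q : (Fin N → ℝ) → ℝ≥0∞ := fun v => μ.map V {M | M *ᵥ v ∈ A}
  have hq0 : q 0 = 0 := by simp [q, h0]
  have hqU : ∀ U ∈ Matrix.orthogonalGroup (Fin N) ℝ, ∀ v, q (U *ᵥ v) = q v := by
    intro U hU v
    simp only [q]
    conv_rhs => rw [← hVr U hU]
    rw [Measure.map_apply hVm (hsec _), Measure.map_apply (f := fun ω => V ω * U) ((meas_mulR U).comp hVm) (hsec _)]
    simp [Set.preimage, Matrix.mulVec_mulVec]
  have hqc : ∀ c : ℝ, 0 < c → ∀ v, q (c • v) = q v := by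
    intro c hc v
    simp only [q, Matrix.mulVec_smul, hs c hc]
  have hqe : ∀ v w : Fin N → ℝ, v ≠ 0 → w ≠ 0 → q v = q w := by
    intro v w hv hw
    have hv' : 0 < v ⬝ᵥ v := lt_of_le_of_ne (Finset.sum_nonneg fun i _ => mul_self_nonneg _)
      (Ne.symm (by rwa [Ne, dotProduct_self_eq_zero]))
    have hw' : 0 < w ⬝ᵥ w := lt_of_le_of_ne (Finset.sum_nonneg fun i _ => mul_self_nonneg _)
      (Ne.symm (by rwa [Ne, dotProduct_self_eq_zero]))
    obtain ⟨U, hU, hUv⟩ := refl_exists v (Real.sqrt ((v ⬝ᵥ v) / (w ⬝ᵥ w)) • w) (by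
      rw [smul_dotProduct, dotProduct_smul, smul_smul, Real.mul_self_sqrt (by positivity)]
      simp only [smul_eq_mul]
      field_simp)
    rw [← hqU U hU v, hUv, hqc _ (by positivity)]
  have hqle : ∀ v, q v ≤ Measure.pi (fun _ : Fin N => gam) A := by
    intro v
    by_cases hv : v = 0
    · rw [hv, hq0]; exact zero_le
    have hNe : Nonempty (Fin N) := by
      by_contra hc
      rw [not_nonempty_iff] at hc
      exact hv (Subsingleton.elim _ _)
    have hnz : ∀ᵐ g ∂(Measure.pi (fun _ : Fin N => gam)), g ≠ 0 := by
      have : NullSingletonClass gam := nullSingletonClass_gaussianReal (by simp)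
      have i0 := hNe.some
      simp only [ae_iff, ne_eq, not_not, Set.ofPred_eq_eq_singleton]
      rw [measure_singleton]
    have e1 : ((μ.map V).prod (Measure.pi (fun _ : Fin N => gam))) S = q v := by
      rw [Measure.prod_apply_symm hSm]
      rw [lintegral_congr_ae (g := fun _ => q v)]
      · simp
      · filter_upwards [hnz] with g hg
        exact hqe g v hg hv
    have e2 : ((μ.map V).prod (Measure.pi (fun _ : Fin N => gam))) S
        = Measure.pi (fun _ : Fin N => gam) A := by
      rw [Measure.prod_apply hSm]
      rw [lintegral_map (measurable_measure_prodMk_left hSm) hVm]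
      have : ∀ ω, Measure.pi (fun _ : Fin N => gam) (Prod.mk (V ω) ⁻¹' S)
          = Measure.pi (fun _ : Fin N => gam) A := by
        intro ω
        conv_rhs => rw [← gauss_rot (V ω) (hVo ω)]
        rw [Measure.map_apply (f := fun v => V ω *ᵥ v) (meas_mulVec.comp measurable_prodMk_left) hA]
        rfl
      simp [this]
    rw [← e1, e2]
  have e3 : μ {ω | V ω *ᵥ y ω ∈ A} = ((μ.map V).prod (μ.map y)) S := by
    rw [← (indepFun_iff_map_prod_eq_prod_map_map hVm.aemeasurable hy.aemeasurable).1 hind,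
      Measure.map_apply (hVm.prodMk hy) hSm]
    rfl
  rw [e3, Measure.prod_apply_symm hSm]
  calc _ ≤ ∫⁻ _, Measure.pi (fun _ : Fin N => gam) A ∂(μ.map y) := lintegral_mono fun v => hqle v
    _ = _ := by simp

noncomputable def sc {N : ℕ} (v : Fin N → ℝ) : ℝ := Real.sqrt ((1 / (N : ℝ)) * ∑ n : Fin N, (v n) ^ 2)

noncomputable def avg {N : ℕ} (F : ℝ → ℝ) (v : Fin N → ℝ) : ℝ := (1 / (N : ℝ)) * ∑ n : Fin N, F (v n)

lemma sc_nonneg {N : ℕ} (v : Fin N → ℝ) : 0 ≤ sc v := Real.sqrt_nonneg _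

lemma sc_sq {N : ℕ} (v : Fin N → ℝ) : sc v ^ 2 = avg (fun y => y ^ 2) v := by
  unfold sc avg
  rw [Real.sq_sqrt]
  exact mul_nonneg (by positivity) (Finset.sum_nonneg fun i _ => sq_nonneg _)

lemma avg_abs {N : ℕ} (v : Fin N → ℝ) : avg (fun y => |y|) v ≤ sc v := by
  apply Real.le_sqrt_of_sq_le
  unfold avg
  rcases Nat.eq_zero_or_pos N with h | h
  · subst h; simp
  have h' : (0:ℝ) < N := by exact_mod_cast h
  have := sq_sum_le_card_mul_sum_sq (s := (Finset.univ : Finset (Fin N))) (f := fun n => |v n|)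
  simp only [Finset.card_univ, Fintype.card_fin, sq_abs] at this
  rw [mul_pow]
  calc _ ≤ (1 / (N:ℝ)) ^ 2 * (N * ∑ i, v i ^ 2) := mul_le_mul_of_nonneg_left this (by positivity)
    _ = _ := by field_simp

lemma avg_diff {N : ℕ} (f : ℝ → ℝ) (L : ℝ) (g : ℝ → ℝ) (v : Fin N → ℝ)
    (hf : ∀ n, |f (v n) - g (v n)| ≤ L * |v n|) (hL : 0 ≤ L) :
    |avg f v - avg g v| ≤ L * sc v := by
  refine le_trans ?_ (mul_le_mul_of_nonneg_left (avg_abs v) hL)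
  unfold avg
  rw [← mul_sub, ← Finset.sum_sub_distrib, abs_mul, abs_of_nonneg (by positivity : 0 ≤ 1 / (N:ℝ)),
    mul_left_comm, Finset.mul_sum]
  refine mul_le_mul_of_nonneg_left ?_ (by positivity)
  exact (Finset.abs_sum_le_sum_abs _ _).trans (Finset.sum_le_sum fun n _ => hf n)

lemma avg_lip {N : ℕ} (f : ℝ → ℝ) (L : ℝ) (hL : 0 ≤ L) (hf : ∀ a b, |f a - f b| ≤ L * |a - b|)
    (r : ℝ) (v : Fin N → ℝ) (hv : sc v ≠ 0) :
    |avg (fun y => f (r * (y / sc v))) v - avg f v| ≤ L * |r - sc v| := by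
  have h := avg_diff (fun y => f (r * (y / sc v))) (L * |r / sc v - 1|) f v (by
    intro n
    refine (hf _ _).trans (le_of_eq ?_)
    rw [mul_assoc, ← abs_mul]
    congr 2
    field_simp) (by positivity)
  refine h.trans (le_of_eq ?_)
  rw [mul_assoc]
  congr 1
  nth_rewrite 2 [← abs_of_nonneg (sc_nonneg v)]
  rw [← abs_mul]
  congr 1
  field_simp

def bad (F : ℝ → ℝ) (m ε : ℝ) (N : ℕ) : Set (Fin N → ℝ) :=
  {v | sc v ≠ 0 ∧ ε ≤ |avg (fun y => F (y / sc v)) v - m|}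

lemma meas_sc {N : ℕ} : Measurable (sc : (Fin N → ℝ) → ℝ) := by
  unfold sc; fun_prop

lemma bad_meas (F : ℝ → ℝ) (hF : Measurable F) (m ε : ℝ) (N : ℕ) : MeasurableSet (bad F m ε N) := by
  have h1 : Measurable (sc : (Fin N → ℝ) → ℝ) := meas_sc
  have h2 : ∀ n : Fin N, Measurable (fun v : Fin N → ℝ => F (v n / sc v)) :=
    fun n => hF.comp ((measurable_pi_apply n).div h1)
  have h3 : Measurable (fun v : Fin N → ℝ => ∑ n, F (v n / sc v)) :=
    Finset.measurable_sum _ fun n _ => h2 n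
  have h4 : Measurable (fun v : Fin N → ℝ => |avg (fun y => F (y / sc v)) v - m|) := by
    unfold avg; fun_prop
  exact MeasurableSet.inter (h1 (measurableSet_singleton 0).compl)
    (measurableSet_le measurable_const h4)

lemma sc_smul {N : ℕ} (c : ℝ) (hc : 0 < c) (v : Fin N → ℝ) : sc (c • v) = c * sc v := by
  unfold sc
  simp only [Pi.smul_apply, smul_eq_mul, mul_pow, ← Finset.mul_sum]
  rw [mul_left_comm, Real.sqrt_mul (by positivity), Real.sqrt_sq hc.le]

lemma bad_scale (F : ℝ → ℝ) (m ε : ℝ) (N : ℕ) (c : ℝ) (hc : 0 < c) (v : Fin N → ℝ) :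
    c • v ∈ bad F m ε N ↔ v ∈ bad F m ε N := by
  unfold bad avg
  simp only [Set.mem_ofPred_eq, sc_smul c hc, Pi.smul_apply, smul_eq_mul,
    mul_div_mul_left _ _ hc.ne', ne_eq, mul_eq_zero, hc.ne', false_or]

lemma bad_zero (F : ℝ → ℝ) (m ε : ℝ) (N : ℕ) : (0 : Fin N → ℝ) ∉ bad F m ε N := by
  simp [bad, sc]

lemma bad_sum (F : ℝ → ℝ) (L : ℝ) (hL : 0 ≤ L) (hF : ∀ a b, |F a - F b| ≤ L * |a - b|)
    (B : ℝ) (hB : ∀ y, |F y| ≤ B) (ε : ℝ) (hε : 0 < ε) :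
    (∑' N : ℕ, (Measure.pi (fun _ : Fin N => gam)) (bad F (∫ y, F y ∂gam) ε N)) ≠ ∞ := by
  have hFm : Measurable F := by
    have : LipschitzWith (Real.toNNReal L) F := LipschitzWith.of_dist_le_mul fun a b => by
      rw [Real.dist_eq, Real.dist_eq, Real.coe_toNNReal _ hL]; exact hF a b
    exact this.continuous.measurable
  set m := ∫ y, F y ∂gam with hm
  have hFi : Integrable F gam := Integrable.of_bound (by fun_prop) B (ae_of_all _ hB)
  have h1 := chern2 (fun y => F y - m) (exp_bdd _ (by fun_prop) (B + |m|) (fun y =>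
    (abs_sub _ _).trans (by gcongr; exact hB y))) (by
      rw [integral_sub hFi (integrable_const _)]; simp [hm]) (ε / 2) (by positivity)
  have h2 := chern2 (fun y => y ^ 2 - 1) exp_sq mean_sq (ε / (2 * (L + 1))) (by positivity)
  have h3 := ENNReal.add_ne_top.2 ⟨h1, h2⟩
  rw [← ENNReal.tsum_add] at h3
  refine ne_top_of_le_ne_top h3 (ENNReal.tsum_le_tsum fun N => ?_)
  refine (measure_mono ?_).trans (measure_union_le _ _)
  rintro v ⟨hv0, hv⟩
  have hN : 0 < (N:ℝ) := by
    rcases Nat.eq_zero_or_pos N with h | h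
    · subst h; simp [sc] at hv0
    · exact_mod_cast h
  by_contra hcon
  simp only [Set.mem_union, Set.mem_ofPred_eq, not_or, not_le, Finset.sum_sub_distrib,
    Finset.sum_const, Finset.card_univ, Fintype.card_fin, nsmul_eq_mul, mul_one] at hcon
  obtain ⟨c1, c2⟩ := hcon
  have key : ∀ (G : ℝ → ℝ) (a δ : ℝ), |∑ n, G (v n) - N * a| < N * δ → |avg G v - a| < δ := by
    intro G a δ h
    have : ∑ n, G (v n) - N * a = N * (avg G v - a) := by
      unfold avg; field_simp
    rw [this, abs_mul, abs_of_pos hN] at h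
    exact lt_of_mul_lt_mul_left h hN.le
  have d1 := key F m _ c1
  have d2 := key (fun y => y ^ 2) 1 _ (by simpa using c2)
  rw [← sc_sq] at d2
  have hs := sc_nonneg v
  have d3 : |1 - sc v| ≤ |sc v ^ 2 - 1| := by
    have : sc v ^ 2 - 1 = -((1 - sc v) * (1 + sc v)) := by ring
    rw [this, abs_neg, abs_mul]
    exact le_mul_of_one_le_right (abs_nonneg _) (by rw [abs_of_nonneg (by linarith)]; linarith)
  have d4 := avg_lip F L hL hF 1 v hv0
  simp only [one_mul] at d4
  have d5 : L * |1 - sc v| ≤ ε / 2 := by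
    have : L * |1 - sc v| ≤ (L + 1) * (ε / (2 * (L + 1))) := by
      apply mul_le_mul (by linarith) (by linarith) (abs_nonneg _) (by linarith)
    refine this.trans (le_of_eq ?_)
    field_simp
  have := abs_sub_le (avg (fun y => F (y / sc v)) v) (avg F v) m
  linarith

lemma dens (G : ℕ → ℝ → ℝ) (G0 : ℝ → ℝ) (K : ℕ → ℝ) (r : ℝ) (hr : 0 < r) (hK : Tendsto K atTop (𝓝 r))
    (hG0 : Continuous G0) (hq : ∀ q : ℚ, Tendsto (fun N => G N q) atTop (𝓝 (G0 q)))
    (hL : ∀ N t s, |G N t - G N s| ≤ |t - s| * K N) (t : ℝ) :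
    Tendsto (fun N => G N t) atTop (𝓝 (G0 t)) := by
  rw [Metric.tendsto_atTop']
  intro ε hε
  have h1 : ∀ᶠ s in 𝓝 t, |G0 s - G0 t| < ε / 3 :=
    Metric.tendsto_nhds.1 (hG0.tendsto t) (ε / 3) (by positivity)
  have h2 : ∀ᶠ s in 𝓝 t, |s - t| < ε / (3 * (r + 1)) :=
    Metric.tendsto_nhds.1 (tendsto_id (α := ℝ) (x := 𝓝 t)) _ (by positivity)
  obtain ⟨U, hU, hUo, htU⟩ := eventually_nhds_iff.1 (h1.and h2)
  obtain ⟨q, hq'⟩ := Rat.denseRange_cast.exists_mem_open hUo ⟨t, htU⟩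
  obtain ⟨a1, a2⟩ := hU _ hq'
  have h3 : ∀ᶠ N in atTop, |G N q - G0 q| < ε / 3 :=
    Metric.tendsto_nhds.1 (hq q) (ε / 3) (by positivity)
  have h4 : ∀ᶠ N in atTop, K N < r + 1 := hK.eventually_lt_const (by linarith)
  obtain ⟨N0, hN0⟩ := eventually_atTop.1 (h3.and h4)
  refine ⟨N0, fun N hN => ?_⟩
  obtain ⟨b1, b2⟩ := hN0 N hN.le
  have b3 := hL N t q
  have b4 : |t - q| * K N ≤ ε / (3 * (r + 1)) * (r + 1) := by
    rw [abs_sub_comm]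
    exact (mul_le_mul_of_nonneg_left b2.le (abs_nonneg _)).trans
      (mul_le_mul_of_nonneg_right a2.le (by linarith))
  have b5 : ε / (3 * (r + 1)) * (r + 1) = ε / 3 := by field_simp
  rw [Real.dist_eq]
  have e1 := abs_sub_le (G N t) (G N q) (G0 t)
  have e2 := abs_sub_le (G N q) (G0 q) (G0 t)
  linarith

lemma main_f {Ω : Type*} [MeasurableSpace Ω] (μ : Measure Ω) [IsProbabilityMeasure μ]
    (x : (N : ℕ) → Ω → (Fin N → ℝ)) (hxmeas : ∀ N, Measurable (x N))
    (O : (N : ℕ) → Ω → Matrix (Fin N) (Fin N) ℝ)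
    (hO : ∀ N, IsHaarOrthogonal μ (O N))
    (hindep : ∀ N, IndepFun (O N) (x N) μ)
    (r : ℝ) (hr : 0 < r)
    (hnorm : ∀ᵐ ω ∂μ, Tendsto (fun N : ℕ => sc (O N ω *ᵥ x N ω)) atTop (𝓝 r))
    (f : ℝ → ℝ) (L : ℝ) (hL : 0 ≤ L) (hf : ∀ a b, |f a - f b| ≤ L * |a - b|)
    (B : ℝ) (hB : ∀ y, |f y| ≤ B) :
    ∀ᵐ ω ∂μ, Tendsto (fun N : ℕ => avg f (O N ω *ᵥ x N ω)) atTop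
      (𝓝 (∫ t, f t ∂(gaussianReal 0 (Real.toNNReal (r ^ 2))))) := by
  have hfm : Measurable f := by
    have : LipschitzWith (Real.toNNReal L) f := LipschitzWith.of_dist_le_mul fun a b => by
      rw [Real.dist_eq, Real.dist_eq, Real.coe_toNNReal _ hL]; exact hf a b
    exact this.continuous.measurable
  have hmap : gaussianReal 0 (Real.toNNReal (r ^ 2)) = gam.map (fun y => r * y) := by
    rw [gaussianReal_map_const_mul]
    congr 1
    · simp
    · ext; simp [sq_nonneg]
  rw [hmap, integral_map (by fun_prop) (by fun_prop)]
  have hFl : ∀ a b, |f (r * a) - f (r * b)| ≤ (L * r) * |a - b| := by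
    intro a b
    refine (hf _ _).trans (le_of_eq ?_)
    rw [← mul_sub, abs_mul, abs_of_pos hr, mul_assoc]
  set m := ∫ y, f (r * y) ∂gam with hm
  have hbc : ∀ k : ℕ, ∀ᵐ ω ∂μ, ∀ᶠ N in atTop,
      (O N ω *ᵥ x N ω) ∉ bad (fun y => f (r * y)) m (1 / ((k:ℝ) + 1)) N := by
    intro k
    have hsum := bad_sum (fun y => f (r * y)) (L * r) (by positivity) hFl B (fun y => hB _)
      (1 / ((k:ℝ) + 1)) (by positivity)
    refine ae_eventually_notMem (s := fun N => {ω | (O N ω *ᵥ x N ω) ∈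
      bad (fun y => f (r * y)) m (1 / ((k:ℝ) + 1)) N}) ?_
    refine ne_top_of_le_ne_top hsum (ENNReal.tsum_le_tsum fun N => ?_)
    exact transfer μ (O N) (hO N) (x N) (hxmeas N) (hindep N) _
      (bad_meas _ (by fun_prop) _ _ _) (fun c hc v => bad_scale _ _ _ _ c hc v) (bad_zero _ _ _ _)
  filter_upwards [ae_all_iff.2 hbc, hnorm] with ω h1 h2
  rw [Metric.tendsto_nhds]
  intro ε hε
  obtain ⟨k, hk⟩ := exists_nat_one_div_lt (half_pos hε)
  have h3 : ∀ᶠ N in atTop, 0 < sc (O N ω *ᵥ x N ω) := h2.eventually_const_lt hr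
  have h4 : ∀ᶠ N in atTop, |sc (O N ω *ᵥ x N ω) - r| < ε / (2 * (L + 1)) :=
    Metric.tendsto_nhds.1 h2 _ (by positivity)
  filter_upwards [h1 k, h3, h4] with N a1 a2 a3
  rw [Real.dist_eq]
  have b1 : |avg (fun y => f (r * (y / sc (O N ω *ᵥ x N ω)))) (O N ω *ᵥ x N ω) - m| < ε / 2 := by
    by_contra hc
    exact a1 ⟨a2.ne', by linarith [not_lt.1 hc]⟩
  have b2 := avg_lip f L hL hf r (O N ω *ᵥ x N ω) a2.ne'
  rw [abs_sub_comm r] at b2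
  have b3 : L * |sc (O N ω *ᵥ x N ω) - r| ≤ ε / 2 := by
    have : L * |sc (O N ω *ᵥ x N ω) - r| ≤ (L + 1) * (ε / (2 * (L + 1))) := by
      apply mul_le_mul (by linarith) a3.le (abs_nonneg _) (by linarith)
    refine this.trans (le_of_eq ?_)
    field_simp
  rw [abs_sub_comm] at b2
  have := abs_sub_le (avg f (O N ω *ᵥ x N ω))
    (avg (fun y => f (r * (y / sc (O N ω *ᵥ x N ω)))) (O N ω *ᵥ x N ω)) m
  linarith

lemma cos_lip (a b : ℝ) : |Real.cos a - Real.cos b| ≤ |a - b| := by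
  have := Convex.norm_image_sub_le_of_norm_deriv_le (f := Real.cos) (s := Set.univ) (C := 1) (x := b) (y := a)
    (fun x _ => Real.differentiableAt_cos) (fun x _ => by
      rw [Real.deriv_cos, norm_neg]; exact Real.abs_sin_le_one x) convex_univ trivial trivial
  simpa using this

lemma sin_lip (a b : ℝ) : |Real.sin a - Real.sin b| ≤ |a - b| := by
  have := Convex.norm_image_sub_le_of_norm_deriv_le (f := Real.sin) (s := Set.univ) (C := 1) (x := b) (y := a)
    (fun x _ => Real.differentiableAt_sin) (fun x _ => by
      rw [Real.deriv_sin]; exact Real.abs_cos_le_one x) convex_univ trivial trivial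
  simpa using this

/-- Real trigonometric integrals converge for all frequencies. -/
lemma main_trig {Ω : Type*} [MeasurableSpace Ω] (μ : Measure Ω) [IsProbabilityMeasure μ]
    (x : (N : ℕ) → Ω → (Fin N → ℝ)) (hxmeas : ∀ N, Measurable (x N))
    (O : (N : ℕ) → Ω → Matrix (Fin N) (Fin N) ℝ)
    (hO : ∀ N, IsHaarOrthogonal μ (O N))
    (hindep : ∀ N, IndepFun (O N) (x N) μ)
    (r : ℝ) (hr : 0 < r)
    (hnorm : ∀ᵐ ω ∂μ, Tendsto (fun N : ℕ => sc (O N ω *ᵥ x N ω)) atTop (𝓝 r))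
    (c : ℝ → ℝ) (hc : ∀ a b, |c a - c b| ≤ |a - b|) (hB : ∀ y, |c y| ≤ 1) :
    ∀ᵐ ω ∂μ, ∀ t : ℝ, Tendsto (fun N : ℕ => avg (fun y => c (t * y)) (O N ω *ᵥ x N ω)) atTop
      (𝓝 (∫ y, c (t * y) ∂(gaussianReal 0 (Real.toNNReal (r ^ 2))))) := by
  have hcc : Continuous c := by
    have : LipschitzWith 1 c := LipschitzWith.of_dist_le_mul fun a b => by
      rw [Real.dist_eq, Real.dist_eq, NNReal.coe_one, one_mul]; exact hc a b
    exact this.continuous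
  have h1 : ∀ q : ℚ, _ := fun q : ℚ => main_f μ x hxmeas O hO hindep r hr hnorm
    (fun y => c ((q:ℝ) * y)) |(q:ℝ)| (abs_nonneg _) (fun a b => by
      refine (hc _ _).trans (le_of_eq ?_)
      rw [← mul_sub, abs_mul]) 1 (fun y => hB _)
  filter_upwards [ae_all_iff.2 h1, hnorm] with ω a1 a2 t
  refine dens (fun N t => avg (fun y => c (t * y)) (O N ω *ᵥ x N ω))
    (fun t => ∫ y, c (t * y) ∂(gaussianReal 0 (Real.toNNReal (r ^ 2)))) _ r hr a2 ?_ a1 ?_ t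
  · refine continuous_of_dominated (bound := fun _ => 1) (fun t => ?_) (fun t => ae_of_all _ fun y => hB _)
      (integrable_const _) (ae_of_all _ fun y => by fun_prop)
    exact (by fun_prop : Continuous fun y => c (t * y)).aestronglyMeasurable
  · intro N t s
    exact avg_diff _ _ _ _ (fun n => (hc _ _).trans (le_of_eq (by rw [← sub_mul, abs_mul]))) (abs_nonneg _)

lemma integral_empDist {N : ℕ}
    (v : Fin N → ℝ) (g : ℝ → ℝ) (hg : Continuous g) :
    ∫ t, g t ∂(empDist v) = (1 / (N:ℝ)) • ∑ n, g (v n) := by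
  unfold empDist
  rw [integral_smul_measure, integral_finsetSum_measure]
  · simp
  · intro i _
    exact integrable_dirac' hg.stronglyMeasurable (by simp)

lemma prob_emp {N : ℕ} (hN : N ≠ 0) (v : Fin N → ℝ) : IsProbabilityMeasure (empDist v) := by
  constructor
  unfold empDist
  simp [Measure.finsetSum_apply]
  exact ENNReal.inv_mul_cancel (by exact_mod_cast hN) (by simp)

lemma charFun_trig (P : Measure ℝ) [IsProbabilityMeasure P] (t : ℝ) :
    charFun P t = ((∫ y, Real.cos (t * y) ∂P : ℝ) : ℂ) + ((∫ y, Real.sin (t * y) ∂P : ℝ) : ℂ) * Complex.I := by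
  rw [charFun_apply_real, ← integral_complex_ofReal, ← integral_complex_ofReal, ← integral_mul_const,
    ← integral_add]
  · congr 1
    ext y
    rw [Complex.exp_mul_I]
    push_cast
    rfl
  · refine Integrable.of_bound (by fun_prop) 1 (ae_of_all _ fun y => ?_)
    rw [Complex.norm_real]; exact Real.abs_cos_le_one _
  · refine Integrable.of_bound (by fun_prop) 1 (ae_of_all _ fun y => ?_)
    rw [norm_mul, Complex.norm_real, Complex.norm_I, mul_one]; exact Real.abs_sin_le_one _

/-- If `x(N)` is an `ℝ^N`-valued random vector with
`√((1/N) ∑ₙ x(N)ₙ²) → r > 0` almost surely, and `O(N)` is a Haar orthogonal random matrix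
independent of `x(N)`, then the empirical distribution of the entries of `h(N) = O(N) x(N)`
converges weakly to `N(0, r²)` almost surely, i.e. almost surely the integral of every bounded
continuous function converges. -/
theorem stmt1 {Ω : Type*} [MeasurableSpace Ω] (μ : Measure Ω) [IsProbabilityMeasure μ]
    (x : (N : ℕ) → Ω → (Fin N → ℝ)) (hxmeas : ∀ N, Measurable (x N))
    (O : (N : ℕ) → Ω → Matrix (Fin N) (Fin N) ℝ)
    (hO : ∀ N, IsHaarOrthogonal μ (O N))
    (hindep : ∀ N, IndepFun (O N) (x N) μ)
    (r : ℝ) (hr : 0 < r)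
    (hnorm : ∀ᵐ ω ∂μ,
      Tendsto (fun N : ℕ => Real.sqrt ((1 / (N : ℝ)) * ∑ n : Fin N, (x N ω n) ^ 2))
        atTop (𝓝 r))
    (h : (N : ℕ) → Ω → (Fin N → ℝ)) (hh : ∀ N ω, h N ω = (O N ω).mulVec (x N ω)) :
    ∀ᵐ ω ∂μ, ∀ f : ℝ →ᵇ ℝ,
      Tendsto (fun N : ℕ => ∫ t, f t ∂(empDist (h N ω))) atTop
        (𝓝 (∫ t, f t ∂(gaussianReal 0 (Real.toNNReal (r ^ 2))))) := by
  obtain rfl : h = fun N ω => (O N ω).mulVec (x N ω) := by funext N ω; exact hh N ω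
  have hn : ∀ᵐ ω ∂μ, Tendsto (fun N : ℕ => sc (O N ω *ᵥ x N ω)) atTop (𝓝 r) := by
    filter_upwards [hnorm] with ω hω
    refine hω.congr fun N => ?_
    unfold sc
    rw [rot_norm _ ((hO N).2.1 ω)]
  filter_upwards [main_trig μ x hxmeas O hO hindep r hr hn Real.cos cos_lip Real.abs_cos_le_one,
    main_trig μ x hxmeas O hO hindep r hr hn Real.sin sin_lip Real.abs_sin_le_one] with ω hc hs f
  let P : ℕ → ProbabilityMeasure ℝ := fun N =>
    ⟨empDist (O (N + 1) ω *ᵥ x (N + 1) ω), prob_emp (Nat.succ_ne_zero N) _⟩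
  let Q : ProbabilityMeasure ℝ := ⟨gaussianReal 0 (Real.toNNReal (r ^ 2)), inferInstance⟩
  have hPQ : Tendsto P atTop (𝓝 Q) := by
    refine ProbabilityMeasure.tendsto_iff_tendsto_charFun.2 fun t => ?_
    simp_rw [charFun_trig]
    have key : ∀ g : ℝ → ℝ, Continuous g → ∀ N : ℕ, ∫ y, g y ∂(P N : Measure ℝ)
        = avg g (O (N + 1) ω *ᵥ x (N + 1) ω) := fun g hg N => integral_empDist _ g hg
    simp_rw [key (fun y => Real.cos (t * y)) (by fun_prop), key (fun y => Real.sin (t * y)) (by fun_prop)]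
    have c1 := (tendsto_add_atTop_iff_nat 1).2 (hc t)
    have s1 := (tendsto_add_atTop_iff_nat 1).2 (hs t)
    exact ((Complex.continuous_ofReal.tendsto _).comp c1).add
      (((Complex.continuous_ofReal.tendsto _).comp s1).mul_const _)
  have := ProbabilityMeasure.tendsto_iff_forall_integral_tendsto.1 hPQ f
  exact (tendsto_add_atTop_iff_nat 1).1 this
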